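/- Let C~, C~′ be r-perfect S-complexes over a commutative ring R, let n ≥ 1 be an integer, and let λ~ = (λ, μ, Δ₁, Δ₂, {τ_i}): C~ → C~′ be a morphism of height −n (respectively, strong height −n). Define λ~′: C~ → Σ^n C~′ by the components λ′(c) = (λ(c), Σ_{i=1}^{n} τ_{−i}δ₁v^{i−1}(c), Σ_{i=2}^{n} τ_{−i}δ₁v^{i−2}(c), …, τ_{−n}δ₁(c)), μ′(c) = (μ(c), Δ₁(c), 0, …, 0), Δ₁′ = 0, Δ₂′(θ) = (Δ₂(θ), τ₀(θ), τ_{−1}(θ), …, τ_{−(n−1)}(θ)), and ρ′ = τ_{−n}. Then λ~′ is a height 0 morphism (strong height 0 if λ~ is strong height −n), and the composition κ~_n ∘ λ~′ (in the sense of the composition formulas for height morphisms) equals λ~. -/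

import Mathlib

set_option maxHeartbeats 1000000

open Function

universe u

/-- A `ℤ`-graded `R`-module, presented as an `R`-module together with a family of submodules
(the homogeneous pieces). -/
structure GradedMod (R : Type u) [CommRing R] : Type (u + 1) where
  carrier : Type u
  [isAddCommGroup : AddCommGroup carrier]
  [isModule : Module R carrier]
  grading : ℤ → Submodule R carrier

attribute [instance] GradedMod.isAddCommGroup GradedMod.isModule

namespace GradedMod

variable {R : Type u} [CommRing R]

/-- `f` is homogeneous of degree `k` with respect to the gradings. -/
def IsDeg (M N : GradedMod R) (k : ℤ) (f : M.carrier →ₗ[R] N.carrier) : Prop :=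
  ∀ i : ℤ, (M.grading i).map f ≤ N.grading (i + k)

/-- The grading is an internal direct sum decomposition with finitely generated free pieces,
only finitely many of which are nonzero; i.e., the graded module is finitely generated and
free as a graded `R`-module. -/
def IsFGFree (M : GradedMod R) : Prop :=
  DirectSum.IsInternal M.grading ∧ (∀ i : ℤ, Module.Free R ↥(M.grading i)) ∧
    (∀ i : ℤ, Module.Finite R ↥(M.grading i)) ∧ {i : ℤ | M.grading i ≠ ⊥}.Finite

/-- `e` is the sign operator `ε`, acting on the degree `i` homogeneous part by `(-1)^i`. -/
def IsSign (M : GradedMod R) (e : M.carrier →ₗ[R] M.carrier) : Prop :=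
  ∀ i : ℤ, ∀ x ∈ M.grading i, e x = if Even i then x else -x

/-- The shift `M[n]`, with `M[n]_j = M_{n+j}`. -/
def shift (M : GradedMod R) (n : ℤ) : GradedMod R where
  carrier := M.carrier
  grading j := M.grading (n + j)

/-- Direct sum (product) of graded modules. -/
def prodGM (M N : GradedMod R) : GradedMod R where
  carrier := M.carrier × N.carrier
  grading j := (M.grading j).prod (N.grading j)

/-- Tensor product of graded modules, `(M ⊗ N)_k = ⊕_{i+j=k} M_i ⊗ N_j`. -/
noncomputable def tensorGM (M N : GradedMod R) : GradedMod R where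
  carrier := TensorProduct R M.carrier N.carrier
  grading k := ⨆ i : ℤ, Submodule.map₂ (TensorProduct.mk R M.carrier N.carrier)
      (M.grading i) (N.grading (k - i))

/-- Dual of a graded module: a functional has degree `-i` if it kills all `M_j`, `j ≠ i`. -/
def dualGM (M : GradedMod R) : GradedMod R where
  carrier := Module.Dual R M.carrier
  grading j := ⨅ (i : ℤ) (_ : i ≠ -j), (M.grading i).dualAnnihilator

end GradedMod

variable {R : Type u} [CommRing R]

/-- Iterated composition of a linear endomorphism. -/
def lpow {M : Type u} [AddCommGroup M] [Module R M] (f : M →ₗ[R] M) : ℕ → (M →ₗ[R] M)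
  | 0 => LinearMap.id
  | n + 1 => f ∘ₗ lpow f n

section ProdHelpers

variable {A B C D E : Type u} [AddCommGroup A] [Module R A] [AddCommGroup B] [Module R B]
  [AddCommGroup C] [Module R C] [AddCommGroup D] [Module R D] [AddCommGroup E] [Module R E]

def pj₁ : (A × B × C) →ₗ[R] A := LinearMap.fst R A (B × C)
def pj₂ : (A × B × C) →ₗ[R] B := (LinearMap.fst R B C) ∘ₗ (LinearMap.snd R A (B × C))
def pj₃ : (A × B × C) →ₗ[R] C := (LinearMap.snd R B C) ∘ₗ (LinearMap.snd R A (B × C))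

def tri (f : D →ₗ[R] A) (g : D →ₗ[R] B) (h : D →ₗ[R] C) : D →ₗ[R] A × B × C :=
  f.prod (g.prod h)

def qj₁ : (A × B × C × D) →ₗ[R] A := LinearMap.fst R A (B × C × D)
def qj₂ : (A × B × C × D) →ₗ[R] B := (LinearMap.fst R B (C × D)) ∘ₗ (LinearMap.snd R A (B × C × D))
def qj₃ : (A × B × C × D) →ₗ[R] C :=
  (LinearMap.fst R C D) ∘ₗ (LinearMap.snd R B (C × D)) ∘ₗ (LinearMap.snd R A (B × C × D))
def qj₄ : (A × B × C × D) →ₗ[R] D :=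
  (LinearMap.snd R C D) ∘ₗ (LinearMap.snd R B (C × D)) ∘ₗ (LinearMap.snd R A (B × C × D))

def quad (f : E →ₗ[R] A) (g : E →ₗ[R] B) (h : E →ₗ[R] C) (l : E →ₗ[R] D) :
    E →ₗ[R] A × B × C × D := f.prod (g.prod (h.prod l))

end ProdHelpers

/-- The data of an `S`-complex over `R`: graded modules `C` (irreducible summand) and
`𝖱` (reducible summand), together with the component maps of the differential
`d~ = [[d, 0, 0], [v, −d, δ₂], [δ₁, 0, r]]` with respect to `C~ = C ⊕ C[-1] ⊕ 𝖱`. -/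
structure SCData (R : Type u) [CommRing R] : Type (u + 1) where
  Irr : GradedMod R
  Red : GradedMod R
  d : Irr.carrier →ₗ[R] Irr.carrier
  v : Irr.carrier →ₗ[R] Irr.carrier
  δ₁ : Irr.carrier →ₗ[R] Red.carrier
  δ₂ : Red.carrier →ₗ[R] Irr.carrier
  r : Red.carrier →ₗ[R] Red.carrier

namespace SCData

/-- The five relations equivalent to `d~ ∘ d~ = 0`. -/
def Relations (S : SCData R) : Prop :=
  S.d ∘ₗ S.d = 0 ∧
  S.δ₁ ∘ₗ S.d + S.r ∘ₗ S.δ₁ = 0 ∧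
  S.d ∘ₗ S.δ₂ - S.δ₂ ∘ₗ S.r = 0 ∧
  S.d ∘ₗ S.v - S.v ∘ₗ S.d - S.δ₂ ∘ₗ S.δ₁ = 0 ∧
  S.r ∘ₗ S.r = 0

/-- The degree conditions making `d~` a degree `−1` map on `C~ = C ⊕ C[-1] ⊕ 𝖱`. -/
def Degrees (S : SCData R) : Prop :=
  S.Irr.IsDeg S.Irr (-1) S.d ∧ S.Irr.IsDeg S.Irr (-2) S.v ∧
  S.Irr.IsDeg S.Red (-1) S.δ₁ ∧ S.Red.IsDeg S.Irr (-2) S.δ₂ ∧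
  S.Red.IsDeg S.Red (-1) S.r

/-- `S` is an `S`-complex. -/
def IsSComplex (S : SCData R) : Prop :=
  S.Irr.IsFGFree ∧ S.Red.IsFGFree ∧ S.Degrees ∧ S.Relations

/-- `S` is `r`-perfect: the reducible summand is concentrated in even degrees
(which forces `r = 0` and `δ₁ ∘ v^i ∘ δ₂ = 0` for all `i ≥ 0`). -/
def RPerfect (S : SCData R) : Prop :=
  (∀ j : ℤ, Odd j → S.Red.grading j = ⊥) ∧ S.r = 0 ∧
    ∀ i : ℕ, S.δ₁ ∘ₗ lpow S.v i ∘ₗ S.δ₂ = 0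

/-- The total graded module `C~ = C ⊕ C[-1] ⊕ 𝖱`. -/
def Tot (S : SCData R) : GradedMod R where
  carrier := S.Irr.carrier × S.Irr.carrier × S.Red.carrier
  grading j := (S.Irr.grading j).prod ((S.Irr.grading (j - 1)).prod (S.Red.grading j))

/-- The total differential `d~(c, c', ρ) = (d c, v c − d c' + δ₂ ρ, δ₁ c + r ρ)`. -/
def totalDiff (S : SCData R) : S.Tot.carrier →ₗ[R] S.Tot.carrier :=
  tri (S.d ∘ₗ pj₁) (S.v ∘ₗ pj₁ - S.d ∘ₗ pj₂ + S.δ₂ ∘ₗ pj₃) (S.δ₁ ∘ₗ pj₁ + S.r ∘ₗ pj₃)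

/-- The map `χ(c, c', ρ) = (0, c, 0)`. -/
def totalChi (S : SCData R) : S.Tot.carrier →ₗ[R] S.Tot.carrier :=
  tri 0 pj₁ 0

/-- The suspension `ΣC~`: `C_Σ = C[-2] ⊕ 𝖱[-1]`, `𝖱_Σ = 𝖱`, with the differential of
Definition 2.9 of the paper. -/
def susp (S : SCData R) : SCData R where
  Irr := { carrier := S.Irr.carrier × S.Red.carrier
           grading := fun j => (S.Irr.grading (j - 2)).prod (S.Red.grading (j - 1)) }
  Red := S.Red
  d := LinearMap.prod
      (S.d ∘ₗ LinearMap.fst R S.Irr.carrier S.Red.carrier -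
        S.δ₂ ∘ₗ LinearMap.snd R S.Irr.carrier S.Red.carrier)
      (-(S.r ∘ₗ LinearMap.snd R S.Irr.carrier S.Red.carrier))
  v := LinearMap.prod (S.v ∘ₗ LinearMap.fst R S.Irr.carrier S.Red.carrier)
      (S.δ₁ ∘ₗ LinearMap.fst R S.Irr.carrier S.Red.carrier)
  δ₁ := LinearMap.snd R S.Irr.carrier S.Red.carrier
  δ₂ := LinearMap.prod (S.v ∘ₗ S.δ₂) (S.δ₁ ∘ₗ S.δ₂)
  r := S.r

/-- The negative suspension `Σ⁻¹C~`: `C_{Σ⁻¹} = C[2] ⊕ 𝖱[2]`, `𝖱_{Σ⁻¹} = 𝖱`. -/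
def negSusp (S : SCData R) : SCData R where
  Irr := { carrier := S.Irr.carrier × S.Red.carrier
           grading := fun j => (S.Irr.grading (j + 2)).prod (S.Red.grading (j + 2)) }
  Red := S.Red
  d := LinearMap.prod (S.d ∘ₗ LinearMap.fst R S.Irr.carrier S.Red.carrier)
      (S.δ₁ ∘ₗ LinearMap.fst R S.Irr.carrier S.Red.carrier +
        S.r ∘ₗ LinearMap.snd R S.Irr.carrier S.Red.carrier)
  v := LinearMap.prod (S.v ∘ₗ LinearMap.fst R S.Irr.carrier S.Red.carrier +
        S.δ₂ ∘ₗ LinearMap.snd R S.Irr.carrier S.Red.carrier) 0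
  δ₁ := S.δ₁ ∘ₗ S.v ∘ₗ LinearMap.fst R S.Irr.carrier S.Red.carrier +
        S.δ₁ ∘ₗ S.δ₂ ∘ₗ LinearMap.snd R S.Irr.carrier S.Red.carrier
  δ₂ := LinearMap.prod 0 LinearMap.id
  r := S.r

/-- `Σ^n`, the `n`-fold (negative) suspension. -/
def suspPow (S : SCData R) : ℤ → SCData R
  | Int.ofNat n => (fun X : SCData R => X.susp)^[n] S
  | Int.negSucc n => (fun X : SCData R => X.negSusp)^[n + 1] S

/-- The shifted `S`-complex `C~[n]`: gradings shifted, same differential and `χ`-map. -/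
def shiftSC (S : SCData R) (n : ℤ) : SCData R where
  Irr := S.Irr.shift n
  Red := S.Red.shift n
  d := S.d
  v := S.v
  δ₁ := S.δ₁
  δ₂ := S.δ₂
  r := S.r

end SCData

/-- A map of `S`-complexes in block form `[[λ, 0, 0], [μ, λ, Δ₂], [Δ₁, 0, ρ]]`
(equivalently, a `χ`-equivariant map `C~ → C~'`); used both for morphisms and
(with appropriate signs in the total interpretation) for homotopies. -/
structure SMap {R : Type u} [CommRing R] (S T : SCData R) : Type u where
  lam : S.Irr.carrier →ₗ[R] T.Irr.carrier
  mu : S.Irr.carrier →ₗ[R] T.Irr.carrier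
  del1 : S.Irr.carrier →ₗ[R] T.Red.carrier
  del2 : S.Red.carrier →ₗ[R] T.Irr.carrier
  rho : S.Red.carrier →ₗ[R] T.Red.carrier

namespace SMap

variable {S T U : SCData R}

/-- The component relations equivalent to `d~' λ~ = λ~ d~`. -/
def IsMor (f : SMap S T) : Prop :=
  T.d ∘ₗ f.lam - f.lam ∘ₗ S.d = 0 ∧
  f.del1 ∘ₗ S.d + f.rho ∘ₗ S.δ₁ - T.δ₁ ∘ₗ f.lam - T.r ∘ₗ f.del1 = 0 ∧
  T.d ∘ₗ f.del2 - T.δ₂ ∘ₗ f.rho + f.lam ∘ₗ S.δ₂ + f.del2 ∘ₗ S.r = 0 ∧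
  f.mu ∘ₗ S.d + T.d ∘ₗ f.mu + f.lam ∘ₗ S.v - T.v ∘ₗ f.lam + f.del2 ∘ₗ S.δ₁ - T.δ₂ ∘ₗ f.del1 = 0 ∧
  f.rho ∘ₗ S.r - T.r ∘ₗ f.rho = 0

/-- The components have the degrees of a degree `k` map of `S`-complexes. -/
def DegreesAt (f : SMap S T) (k : ℤ) : Prop :=
  S.Irr.IsDeg T.Irr k f.lam ∧ S.Irr.IsDeg T.Irr (k - 1) f.mu ∧
  S.Irr.IsDeg T.Red k f.del1 ∧ S.Red.IsDeg T.Irr (k - 1) f.del2 ∧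
  S.Red.IsDeg T.Red k f.rho

/-- Composition of morphisms of `S`-complexes, componentwise. -/
def comp (g : SMap T U) (f : SMap S T) : SMap S U where
  lam := g.lam ∘ₗ f.lam
  mu := g.lam ∘ₗ f.mu + g.mu ∘ₗ f.lam + g.del2 ∘ₗ f.del1
  del1 := g.del1 ∘ₗ f.lam + g.rho ∘ₗ f.del1
  del2 := g.lam ∘ₗ f.del2 + g.del2 ∘ₗ f.rho
  rho := g.rho ∘ₗ f.rho

/-- `K` is an `S`-chain homotopy from `f` to `g`, i.e. `d~' K~ + K~ d~ = λ~ - λ~'` where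
`K~ = [[K, 0, 0], [L, -K, M₂], [M₁, 0, J]]`, in component form. -/
def IsHtpyFrom (K f g : SMap S T) : Prop :=
  T.d ∘ₗ K.lam + K.lam ∘ₗ S.d - f.lam + g.lam = 0 ∧
  T.δ₁ ∘ₗ K.lam + T.r ∘ₗ K.del1 + K.del1 ∘ₗ S.d + K.rho ∘ₗ S.δ₁ - f.del1 + g.del1 = 0 ∧
  -(T.d ∘ₗ K.del2) + T.δ₂ ∘ₗ K.rho - K.lam ∘ₗ S.δ₂ + K.del2 ∘ₗ S.r - f.del2 + g.del2 = 0 ∧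
  T.v ∘ₗ K.lam - T.d ∘ₗ K.mu + T.δ₂ ∘ₗ K.del1 + K.mu ∘ₗ S.d - K.lam ∘ₗ S.v + K.del2 ∘ₗ S.δ₁
    - f.mu + g.mu = 0 ∧
  T.r ∘ₗ K.rho + K.rho ∘ₗ S.r - f.rho + g.rho = 0

end SMap

/-- The identity morphism. -/
def idMap (S : SCData R) : SMap S S where
  lam := LinearMap.id
  mu := 0
  del1 := 0
  del2 := 0
  rho := LinearMap.id

/-- The total map `C~ → C~'` of a morphism in block form. -/
def morTotal {S T : SCData R} (f : SMap S T) : S.Tot.carrier →ₗ[R] T.Tot.carrier :=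
  tri (f.lam ∘ₗ pj₁) (f.mu ∘ₗ pj₁ + f.lam ∘ₗ pj₂ + f.del2 ∘ₗ pj₃) (f.del1 ∘ₗ pj₁ + f.rho ∘ₗ pj₃)

/-- The total map `C~ → C~'` of a homotopy in block form. -/
def htpTotal {S T : SCData R} (K : SMap S T) : S.Tot.carrier →ₗ[R] T.Tot.carrier :=
  tri (K.lam ∘ₗ pj₁) (K.mu ∘ₗ pj₁ - K.lam ∘ₗ pj₂ + K.del2 ∘ₗ pj₃) (K.del1 ∘ₗ pj₁ + K.rho ∘ₗ pj₃)

/-- `S`-chain homotopy equivalence of `S`-complexes. -/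
def SHomotopyEquiv (S T : SCData R) : Prop :=
  ∃ (f : SMap S T) (g : SMap T S) (H₁ : SMap S S) (H₂ : SMap T T),
    f.IsMor ∧ f.DegreesAt 0 ∧ g.IsMor ∧ g.DegreesAt 0 ∧
    H₁.DegreesAt 1 ∧ SMap.IsHtpyFrom H₁ (g.comp f) (idMap S) ∧
    H₂.DegreesAt 1 ∧ SMap.IsHtpyFrom H₂ (f.comp g) (idMap T)

/-- Isomorphism of `S`-complexes: a (degree `0`) morphism with a two-sided inverse morphism. -/
def SIso (S T : SCData R) : Prop :=
  ∃ (f : SMap S T) (g : SMap T S), f.IsMor ∧ f.DegreesAt 0 ∧ g.IsMor ∧ g.DegreesAt 0 ∧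
    g.comp f = idMap S ∧ f.comp g = idMap T

/-- The suspension `Σλ~` of a morphism `λ~`, in block form. -/
def suspMap {S T : SCData R} (f : SMap S T) : SMap S.susp T.susp where
  lam := LinearMap.prod
      (f.lam ∘ₗ LinearMap.fst R S.Irr.carrier S.Red.carrier +
        f.del2 ∘ₗ LinearMap.snd R S.Irr.carrier S.Red.carrier)
      (f.rho ∘ₗ LinearMap.snd R S.Irr.carrier S.Red.carrier)
  mu := LinearMap.prod (f.mu ∘ₗ LinearMap.fst R S.Irr.carrier S.Red.carrier)
      (f.del1 ∘ₗ LinearMap.fst R S.Irr.carrier S.Red.carrier)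
  del1 := 0
  del2 := LinearMap.prod (f.mu ∘ₗ S.δ₂ + T.v ∘ₗ f.del2) (f.del1 ∘ₗ S.δ₂ + T.δ₁ ∘ₗ f.del2)
  rho := f.rho

/-- The suspension `ΣK~` of a homotopy `K~`, in block form. -/
def suspHtpy {S T : SCData R} (K : SMap S T) : SMap S.susp T.susp where
  lam := LinearMap.prod
      (K.lam ∘ₗ LinearMap.fst R S.Irr.carrier S.Red.carrier -
        K.del2 ∘ₗ LinearMap.snd R S.Irr.carrier S.Red.carrier)
      (-(K.rho ∘ₗ LinearMap.snd R S.Irr.carrier S.Red.carrier))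
  mu := LinearMap.prod (K.mu ∘ₗ LinearMap.fst R S.Irr.carrier S.Red.carrier)
      (K.del1 ∘ₗ LinearMap.fst R S.Irr.carrier S.Red.carrier)
  del1 := 0
  del2 := LinearMap.prod (T.v ∘ₗ K.del2 + K.mu ∘ₗ S.δ₂) (T.δ₁ ∘ₗ K.del2 + K.del1 ∘ₗ S.δ₂)
  rho := K.rho

/-- The sequence `τ_0 = ρ`, `τ_{i+1} = δ₁'v'^iΔ₂ + Δ₁v^iδ₂ + Σ_{j<i} δ₁'v'^j μ v^{i−1−j} δ₂`
attached to an (even degree) morphism between `r`-perfect `S`-complexes. -/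
def tauSMap {S T : SCData R} (f : SMap S T) : ℕ → (S.Red.carrier →ₗ[R] T.Red.carrier)
  | 0 => f.rho
  | i + 1 =>
      T.δ₁ ∘ₗ lpow T.v i ∘ₗ f.del2 + f.del1 ∘ₗ lpow S.v i ∘ₗ S.δ₂ +
        ∑ j ∈ Finset.range i, T.δ₁ ∘ₗ lpow T.v j ∘ₗ f.mu ∘ₗ lpow S.v (i - 1 - j) ∘ₗ S.δ₂

/-- Height `n` (for `n ≥ 0`): `τ_j = 0` for `0 ≤ j < n`. -/
def SMap.HasHeight {S T : SCData R} (f : SMap S T) (n : ℕ) : Prop :=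
  ∀ j : ℕ, j < n → tauSMap f j = 0

/-- Strong height `n`: height `n` and `τ_n` an isomorphism. -/
def SMap.StrongHeight {S T : SCData R} (f : SMap S T) (n : ℕ) : Prop :=
  f.HasHeight n ∧ Function.Bijective ⇑(tauSMap f n)

/-- The explicit model of the `n`-fold suspension `Σ^n C~` of an `r`-perfect `S`-complex:
`C_{Σ^n} = C[-2n] ⊕ ⊕_{i=0}^{n-1} 𝖱[-2i-1]` (the `m`-th factor of `Fin n → 𝖱` being
`𝖱[-2(n-1-m)-1]`), `𝖱_{Σ^n} = 𝖱`, with the components of the differential as in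
Subsection 2.4 of the paper. -/
def SCData.suspN (S : SCData R) (n : ℕ) : SCData R where
  Irr := { carrier := S.Irr.carrier × (Fin n → S.Red.carrier)
           grading := fun j => (S.Irr.grading (j - 2 * (n : ℤ))).prod
             (Submodule.pi Set.univ fun m : Fin n =>
               S.Red.grading (j - 2 * (((n - 1 - (m : ℕ) : ℕ)) : ℤ) - 1)) }
  Red := S.Red
  d := LinearMap.prod
      (S.d ∘ₗ LinearMap.fst R S.Irr.carrier (Fin n → S.Red.carrier) -
        ∑ m : Fin n, lpow S.v (m : ℕ) ∘ₗ S.δ₂ ∘ₗ LinearMap.proj m ∘ₗ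
          LinearMap.snd R S.Irr.carrier (Fin n → S.Red.carrier)) 0
  v := LinearMap.prod (S.v ∘ₗ LinearMap.fst R S.Irr.carrier (Fin n → S.Red.carrier))
      (LinearMap.pi fun m : Fin n =>
        if (m : ℕ) = 0 then S.δ₁ ∘ₗ LinearMap.fst R S.Irr.carrier (Fin n → S.Red.carrier)
        else LinearMap.proj (⟨(m : ℕ) - 1, lt_of_le_of_lt (Nat.sub_le _ _) m.isLt⟩ : Fin n) ∘ₗ
          LinearMap.snd R S.Irr.carrier (Fin n → S.Red.carrier))
  δ₁ := if h : 0 < n then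
      LinearMap.proj (⟨n - 1, Nat.sub_lt h Nat.one_pos⟩ : Fin n) ∘ₗ
        LinearMap.snd R S.Irr.carrier (Fin n → S.Red.carrier)
    else 0
  δ₂ := LinearMap.prod (lpow S.v n ∘ₗ S.δ₂) 0
  r := 0

/-- The natural morphism `ι~_n : C~ → Σ^n C~`, with `λ`-component `c ↦ (c, 0, …, 0)` and
`Δ₂`-component `θ ↦ (0, θ, 0, …, 0)`. -/
def iotaN (S : SCData R) (n : ℕ) : SMap S (S.suspN n) where
  lam := LinearMap.prod LinearMap.id 0
  mu := 0
  del1 := 0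
  del2 := LinearMap.prod 0 (LinearMap.pi fun m : Fin n => if (m : ℕ) = 0 then LinearMap.id else 0)
  rho := 0

/-- The data of a generalized height morphism between `r`-perfect `S`-complexes:
the four maps `λ, μ, Δ₁, Δ₂` and the sequence `τ_i` for `i ∈ ℤ`. -/
structure HMor {R : Type u} [CommRing R] (S T : SCData R) : Type u where
  lam : S.Irr.carrier →ₗ[R] T.Irr.carrier
  mu : S.Irr.carrier →ₗ[R] T.Irr.carrier
  del1 : S.Irr.carrier →ₗ[R] T.Red.carrier
  del2 : S.Red.carrier →ₗ[R] T.Irr.carrier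
  tau : ℤ → (S.Red.carrier →ₗ[R] T.Red.carrier)

/-- `f` is a height `n` morphism of (even) degree `k` between `r`-perfect `S`-complexes. -/
def HMor.IsHeightMor {S T : SCData R} (f : HMor S T) (n : ℤ) (k : ℤ) : Prop :=
  Even k ∧
  S.Irr.IsDeg T.Irr k f.lam ∧ S.Irr.IsDeg T.Irr (k - 1) f.mu ∧
  S.Irr.IsDeg T.Red k f.del1 ∧ S.Red.IsDeg T.Irr (k - 1) f.del2 ∧
  (∀ i : ℤ, S.Red.IsDeg T.Red (k - 2 * i) (f.tau i)) ∧
  (∀ i : ℤ, i < n → f.tau i = 0) ∧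
  (∀ i : ℕ, f.tau ((i : ℤ) + 1) =
      T.δ₁ ∘ₗ lpow T.v i ∘ₗ f.del2 + f.del1 ∘ₗ lpow S.v i ∘ₗ S.δ₂ +
        ∑ j ∈ Finset.range i, T.δ₁ ∘ₗ lpow T.v j ∘ₗ f.mu ∘ₗ lpow S.v (i - 1 - j) ∘ₗ S.δ₂) ∧
  (T.d ∘ₗ f.lam - f.lam ∘ₗ S.d -
      ∑ᶠ i : ℕ, ∑ j ∈ Finset.range (i + 1),
        lpow T.v j ∘ₗ T.δ₂ ∘ₗ f.tau (-((i : ℤ) + 1)) ∘ₗ S.δ₁ ∘ₗ lpow S.v (i - j) = 0) ∧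
  (-(T.δ₁ ∘ₗ f.lam) + f.del1 ∘ₗ S.d + ∑ᶠ i : ℕ, f.tau (-(i : ℤ)) ∘ₗ S.δ₁ ∘ₗ lpow S.v i = 0) ∧
  (f.lam ∘ₗ S.δ₂ + T.d ∘ₗ f.del2 - ∑ᶠ i : ℕ, lpow T.v i ∘ₗ T.δ₂ ∘ₗ f.tau (-(i : ℤ)) = 0) ∧
  (f.mu ∘ₗ S.d + T.d ∘ₗ f.mu + f.lam ∘ₗ S.v - T.v ∘ₗ f.lam + f.del2 ∘ₗ S.δ₁ - T.δ₂ ∘ₗ f.del1 = 0)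

/-- Composition of generalized height morphisms (Definition 2.23 of the paper). -/
noncomputable def HMor.compH {S T U : SCData R} (g : HMor T U) (f : HMor S T) : HMor S U where
  lam := g.lam ∘ₗ f.lam
    + (∑ᶠ i : ℕ, ∑ j ∈ Finset.range (i + 1),
        lpow U.v j ∘ₗ U.δ₂ ∘ₗ g.tau (-((i : ℤ) + 1)) ∘ₗ f.del1 ∘ₗ lpow S.v (i - j))
    + (∑ᶠ i : ℕ, ∑ j ∈ Finset.range (i + 1),
        lpow U.v j ∘ₗ g.del2 ∘ₗ f.tau (-((i : ℤ) + 1)) ∘ₗ S.δ₁ ∘ₗ lpow S.v (i - j))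
    + (∑ᶠ i : ℕ, ∑ j ∈ Finset.range (i + 1), ∑ l ∈ Finset.range (i - j + 1),
        lpow U.v j ∘ₗ U.δ₂ ∘ₗ g.tau (-((i : ℤ) + 2)) ∘ₗ T.δ₁ ∘ₗ lpow T.v l ∘ₗ f.mu ∘ₗ
          lpow S.v (i - j - l))
    + (∑ᶠ i : ℕ, ∑ j ∈ Finset.range (i + 1), ∑ l ∈ Finset.range (i - j + 1),
        lpow U.v j ∘ₗ g.mu ∘ₗ lpow T.v l ∘ₗ T.δ₂ ∘ₗ f.tau (-((i : ℤ) + 2)) ∘ₗ S.δ₁ ∘ₗ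
          lpow S.v (i - j - l))
  mu := g.lam ∘ₗ f.mu + g.mu ∘ₗ f.lam + g.del2 ∘ₗ f.del1
  del1 := g.del1 ∘ₗ f.lam + (∑ᶠ i : ℕ, g.tau (-(i : ℤ)) ∘ₗ f.del1 ∘ₗ lpow S.v i)
    + (∑ᶠ i : ℕ, ∑ j ∈ Finset.range (i + 1),
        g.tau (-((i : ℤ) + 1)) ∘ₗ T.δ₁ ∘ₗ lpow T.v j ∘ₗ f.mu ∘ₗ lpow S.v (i - j))
  del2 := g.lam ∘ₗ f.del2 + (∑ᶠ i : ℕ, lpow U.v i ∘ₗ g.del2 ∘ₗ f.tau (-(i : ℤ)))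
    + (∑ᶠ i : ℕ, ∑ j ∈ Finset.range (i + 1),
        lpow U.v j ∘ₗ g.mu ∘ₗ lpow T.v (i - j) ∘ₗ T.δ₂ ∘ₗ f.tau (-((i : ℤ) + 1)))
  tau := fun i => ∑ᶠ l : ℤ, g.tau (i - l) ∘ₗ f.tau l

/-- The strong height `−n` morphism `κ~_n : Σ^n C~ → C~`. -/
def kappaN (T : SCData R) (n : ℕ) : HMor (T.suspN n) T where
  lam := LinearMap.fst R T.Irr.carrier (Fin n → T.Red.carrier)
  mu := 0
  del1 := 0
  del2 := 0
  tau := fun i => if i = -(n : ℤ) then LinearMap.id else 0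

/-- An (even degree) morphism of `S`-complexes, regarded as a generalized height morphism. -/
def SMap.toHMor {S T : SCData R} (f : SMap S T) : HMor S T where
  lam := f.lam
  mu := f.mu
  del1 := f.del1
  del2 := f.del2
  tau := fun i => if 0 ≤ i then tauSMap f i.toNat else 0

/-- The height `0` morphism `λ~' : C~ → Σ^n C~'` associated to a height `−n` morphism
(Proposition 2.25 of the paper). -/
def heightNegToSusp {S T : SCData R} (f : HMor S T) (n : ℕ) : SMap S (T.suspN n) where
  lam := LinearMap.prod f.lam
    (LinearMap.pi fun m : Fin n =>
      ∑ i ∈ Finset.Icc ((m : ℕ) + 1) n, f.tau (-(i : ℤ)) ∘ₗ S.δ₁ ∘ₗ lpow S.v (i - 1 - (m : ℕ)))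
  mu := LinearMap.prod f.mu (LinearMap.pi fun m : Fin n => if (m : ℕ) = 0 then f.del1 else 0)
  del1 := 0
  del2 := LinearMap.prod f.del2 (LinearMap.pi fun m : Fin n => f.tau (-((m : ℕ) : ℤ)))
  rho := f.tau (-(n : ℤ))

/-- The morphism `ι~₁ : C~ → ΣC~`. -/
def iotaOne (S : SCData R) : SMap S S.susp where
  lam := LinearMap.prod LinearMap.id 0
  mu := 0
  del1 := 0
  del2 := LinearMap.prod 0 LinearMap.id
  rho := 0

/-- The morphism `λ~'' : ΣC~' → C~''` associated to an odd degree morphism `λ~'` together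
with the map `ν' : 𝖱' → 𝖱''` (Subsection 2.6 of the paper). -/
def lambdaSecond {S T : SCData R} (f : SMap S T) (nu : S.Red.carrier →ₗ[R] T.Red.carrier) :
    SMap S.susp T where
  lam := f.lam ∘ₗ LinearMap.fst R S.Irr.carrier S.Red.carrier +
    f.del2 ∘ₗ LinearMap.snd R S.Irr.carrier S.Red.carrier
  mu := f.mu ∘ₗ LinearMap.fst R S.Irr.carrier S.Red.carrier
  del1 := f.del1 ∘ₗ LinearMap.fst R S.Irr.carrier S.Red.carrier +
    nu ∘ₗ LinearMap.snd R S.Irr.carrier S.Red.carrier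
  del2 := f.mu ∘ₗ S.δ₂ + T.v ∘ₗ f.del2 + T.δ₂ ∘ₗ nu
  rho := 0

/-- The morphism `λ~₁ : C~ → ΣC~'` associated to height `−1` morphism data
`(λ, μ, Δ₁, Δ₂, τ₀, τ₋₁)`, in block form
`[[λ, 0, 0], [τ₋₁δ₁, 0, 0], [μ, λ, Δ₂], [Δ₁, τ₋₁δ₁, τ₀], [0, 0, τ₋₁]]`. -/
def hNegOneSusp {S T : SCData R} (lam0 mu0 : S.Irr.carrier →ₗ[R] T.Irr.carrier)
    (del10 : S.Irr.carrier →ₗ[R] T.Red.carrier) (del20 : S.Red.carrier →ₗ[R] T.Irr.carrier)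
    (tau0 taum1 : S.Red.carrier →ₗ[R] T.Red.carrier) : SMap S T.susp where
  lam := LinearMap.prod lam0 (taum1 ∘ₗ S.δ₁)
  mu := LinearMap.prod mu0 del10
  del1 := 0
  del2 := LinearMap.prod del20 tau0
  rho := taum1

/-- The mapping cone of a degree `k` morphism `λ~ : C~ → C~'`, as an `S`-complex;
its underlying graded module is `C~[-1-k] ⊕ C~'`. -/
def coneSC {S T : SCData R} (f : SMap S T) (k : ℤ) : SCData R where
  Irr := { carrier := S.Irr.carrier × T.Irr.carrier
           grading := fun j => (S.Irr.grading (j - 1 - k)).prod (T.Irr.grading j) }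
  Red := { carrier := S.Red.carrier × T.Red.carrier
           grading := fun j => (S.Red.grading (j - 1 - k)).prod (T.Red.grading j) }
  d := LinearMap.prod (-(S.d ∘ₗ LinearMap.fst R S.Irr.carrier T.Irr.carrier))
      (f.lam ∘ₗ LinearMap.fst R S.Irr.carrier T.Irr.carrier +
        T.d ∘ₗ LinearMap.snd R S.Irr.carrier T.Irr.carrier)
  v := LinearMap.prod (S.v ∘ₗ LinearMap.fst R S.Irr.carrier T.Irr.carrier)
      (f.mu ∘ₗ LinearMap.fst R S.Irr.carrier T.Irr.carrier +
        T.v ∘ₗ LinearMap.snd R S.Irr.carrier T.Irr.carrier)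
  δ₁ := LinearMap.prod (-(S.δ₁ ∘ₗ LinearMap.fst R S.Irr.carrier T.Irr.carrier))
      (f.del1 ∘ₗ LinearMap.fst R S.Irr.carrier T.Irr.carrier +
        T.δ₁ ∘ₗ LinearMap.snd R S.Irr.carrier T.Irr.carrier)
  δ₂ := LinearMap.prod (S.δ₂ ∘ₗ LinearMap.fst R S.Red.carrier T.Red.carrier)
      (f.del2 ∘ₗ LinearMap.fst R S.Red.carrier T.Red.carrier +
        T.δ₂ ∘ₗ LinearMap.snd R S.Red.carrier T.Red.carrier)
  r := LinearMap.prod (-(S.r ∘ₗ LinearMap.fst R S.Red.carrier T.Red.carrier))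
      (f.rho ∘ₗ LinearMap.fst R S.Red.carrier T.Red.carrier +
        T.r ∘ₗ LinearMap.snd R S.Red.carrier T.Red.carrier)

/-- Direct sum of `S`-complexes. -/
def sumSC (S T : SCData R) : SCData R where
  Irr := S.Irr.prodGM T.Irr
  Red := S.Red.prodGM T.Red
  d := S.d.prodMap T.d
  v := S.v.prodMap T.v
  δ₁ := S.δ₁.prodMap T.δ₁
  δ₂ := S.δ₂.prodMap T.δ₂
  r := S.r.prodMap T.r

/-- The dual `S`-complex `C~†`, defined using sign operators on the dual graded modules:
`m†(f) = −ε(f) f ∘ m`, with the roles of `δ₁` and `δ₂` interchanged. -/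
def dualSC (S : SCData R)
    (eCd : Module.Dual R S.Irr.carrier →ₗ[R] Module.Dual R S.Irr.carrier)
    (eRd : Module.Dual R S.Red.carrier →ₗ[R] Module.Dual R S.Red.carrier) : SCData R where
  Irr := S.Irr.dualGM
  Red := S.Red.dualGM
  d := -(S.d.dualMap ∘ₗ eCd)
  v := -(S.v.dualMap ∘ₗ eCd)
  δ₁ := -(S.δ₂.dualMap ∘ₗ eCd)
  δ₂ := -(S.δ₁.dualMap ∘ₗ eRd)
  r := -(S.r.dualMap ∘ₗ eRd)

/-- The rank-one graded module `R`, concentrated in degree `n`. -/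
def unitGM (R : Type u) [CommRing R] (n : ℤ) : GradedMod R where
  carrier := R
  grading j := if j = n then ⊤ else ⊥

/-- The `S`-complex `O~(1)`: `C = R` in degree `1`, `𝖱 = R` in degree `0`, `δ₁ = id`. -/
def O1 (R : Type u) [CommRing R] : SCData R where
  Irr := unitGM R 1
  Red := unitGM R 0
  d := 0
  v := 0
  δ₁ := LinearMap.id
  δ₂ := 0
  r := 0

/-- The `S`-complex `O~(-1)`: `C = R` in degree `-2`, `𝖱 = R` in degree `0`, `δ₂ = id`. -/
def Om1 (R : Type u) [CommRing R] : SCData R where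
  Irr := unitGM R (-2)
  Red := unitGM R 0
  d := 0
  v := 0
  δ₁ := 0
  δ₂ := LinearMap.id
  r := 0

/-- The `S`-complex `O~(0)`: `C = 0`, `𝖱 = R` in degree `0`, zero differential. -/
def O0 (R : Type u) [CommRing R] : SCData R where
  Irr := { carrier := ↥(⊥ : Submodule R R), grading := fun _ => ⊥ }
  Red := unitGM R 0
  d := 0
  v := 0
  δ₁ := 0
  δ₂ := 0
  r := 0

/-- The `S`-complex representation of the tensor product `C~ ⊗ C~'` of `S`-complexes
(Subsection 2.2 of the paper), where `eC`, `eR` are the sign operators of the first factor: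
`C^⊗ = (C⊗C') ⊕ (C⊗C')[-1] ⊕ (C⊗𝖱') ⊕ (𝖱⊗C')` and `𝖱^⊗ = 𝖱⊗𝖱'`. -/
noncomputable def tensorRep (S T : SCData R)
    (eC : S.Irr.carrier →ₗ[R] S.Irr.carrier) (eR : S.Red.carrier →ₗ[R] S.Red.carrier) :
    SCData R where
  Irr := (S.Irr.tensorGM T.Irr).prodGM (((S.Irr.tensorGM T.Irr).shift (-1)).prodGM
      ((S.Irr.tensorGM T.Red).prodGM (S.Red.tensorGM T.Irr)))
  Red := S.Red.tensorGM T.Red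
  d := quad
      (TensorProduct.map S.d LinearMap.id ∘ₗ qj₁ + TensorProduct.map eC T.d ∘ₗ qj₁)
      (TensorProduct.map (-(eC ∘ₗ S.v)) LinearMap.id ∘ₗ qj₁ + TensorProduct.map eC T.v ∘ₗ qj₁
        + TensorProduct.map S.d LinearMap.id ∘ₗ qj₂ - TensorProduct.map eC T.d ∘ₗ qj₂
        + TensorProduct.map eC T.δ₂ ∘ₗ qj₃
        + TensorProduct.map (-(eC ∘ₗ S.δ₂)) LinearMap.id ∘ₗ qj₄)
      (TensorProduct.map eC T.δ₁ ∘ₗ qj₁ + TensorProduct.map S.d LinearMap.id ∘ₗ qj₃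
        + TensorProduct.map eC T.r ∘ₗ qj₃)
      (TensorProduct.map S.δ₁ LinearMap.id ∘ₗ qj₁ + TensorProduct.map eR T.d ∘ₗ qj₄
        + TensorProduct.map S.r LinearMap.id ∘ₗ qj₄)
  v := quad
      (TensorProduct.map S.v LinearMap.id ∘ₗ qj₁ + TensorProduct.map S.δ₂ LinearMap.id ∘ₗ qj₄)
      (TensorProduct.map S.v LinearMap.id ∘ₗ qj₂)
      (TensorProduct.map S.v LinearMap.id ∘ₗ qj₃)
      (TensorProduct.map (eR ∘ₗ S.δ₁) LinearMap.id ∘ₗ qj₂ + TensorProduct.map LinearMap.id T.v ∘ₗ qj₄)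
  δ₁ := TensorProduct.map S.δ₁ LinearMap.id ∘ₗ qj₃ + TensorProduct.map eR T.δ₁ ∘ₗ qj₄
  δ₂ := quad 0 0 (TensorProduct.map S.δ₂ LinearMap.id) (TensorProduct.map LinearMap.id T.δ₂)
  r := TensorProduct.map S.r LinearMap.id + TensorProduct.map eR T.r

/-- Homology of an endomorphism (thought of as a differential): `ker D / im D`. -/
abbrev homologyOf {M : Type u} [AddCommGroup M] [Module R M] (D : M →ₗ[R] M) : Type u :=
  ↥(LinearMap.ker D) ⧸
    Submodule.comap (LinearMap.ker D).subtype (LinearMap.range D)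

/-- The map induced on homology by a chain map. -/
def inducedMap {M N : Type u} [AddCommGroup M] [Module R M] [AddCommGroup N] [Module R N]
    (DM : M →ₗ[R] M) (DN : N →ₗ[R] N) (f : M →ₗ[R] N) (h : DN ∘ₗ f = f ∘ₗ DM) :
    homologyOf DM →ₗ[R] homologyOf DN :=
  Submodule.mapQ _ _
    (f.restrict (p := LinearMap.ker DM) (q := LinearMap.ker DN) (fun x hx => by
      have h1 : DN (f x) = f (DM x) := by
        have h2 := LinearMap.congr_fun h x
        simpa using h2
      have hx0 : DM x = 0 := LinearMap.mem_ker.mp hx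
      simp [LinearMap.mem_ker, h1, hx0]))
    (by
      intro x hx
      simp only [Submodule.mem_comap] at hx ⊢
      obtain ⟨y, hy⟩ := hx
      refine ⟨f y, ?_⟩
      have h1 : DN (f y) = f (DM y) := by
        have h2 := LinearMap.congr_fun h y
        simpa using h2
      simp only [Submodule.coe_subtype] at hy ⊢
      rw [LinearMap.restrict_apply]
      rw [h1, hy])

/-- The degree `j` homology of a graded module with a (degree `-1`) differential. -/
abbrev gradedHomology (M : GradedMod R) (D : M.carrier →ₗ[R] M.carrier) (j : ℤ) : Type u :=
  ↥(M.grading j ⊓ LinearMap.ker D) ⧸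
    Submodule.comap (M.grading j ⊓ LinearMap.ker D).subtype ((M.grading (j + 1)).map D)

/-- The Euler characteristic `Σ_j (-1)^j rk_R M_j` of a graded module. -/
noncomputable def eulerChar (M : GradedMod R) : ℤ :=
  ∑ᶠ j : ℤ, (if Even j then (1 : ℤ) else -1) * (Module.finrank R ↥(M.grading j) : ℤ)

/-- The small equivariant complex `Ĉ = C[-1] ⊕ 𝖱[x]`, with `𝖱[x]` modelled as `ℕ →₀ 𝖱`. -/
abbrev hatC (S : SCData R) : Type u := S.Irr.carrier × (ℕ →₀ S.Red.carrier)

/-- The differential `𝔡̂(α, θxⁱ) = (dα − vⁱδ₂θ, 0)`. -/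
noncomputable def hatD (S : SCData R) : hatC S →ₗ[R] hatC S :=
  LinearMap.prod
    (S.d ∘ₗ LinearMap.fst R S.Irr.carrier (ℕ →₀ S.Red.carrier) -
      (Finsupp.lsum ℕ fun i : ℕ => lpow S.v i ∘ₗ S.δ₂) ∘ₗ
        LinearMap.snd R S.Irr.carrier (ℕ →₀ S.Red.carrier))
    0

/-- The `x`-action `x·(α, θxⁱ) = (vα, δ₁α + θx^{i+1})` on `Ĉ`. -/
noncomputable def hatX (S : SCData R) : hatC S →ₗ[R] hatC S :=
  LinearMap.prod (S.v ∘ₗ LinearMap.fst R S.Irr.carrier (ℕ →₀ S.Red.carrier))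
    (Finsupp.lsingle 0 ∘ₗ S.δ₁ ∘ₗ LinearMap.fst R S.Irr.carrier (ℕ →₀ S.Red.carrier) +
      Finsupp.lmapDomain S.Red.carrier R (fun i => i + 1) ∘ₗ
        LinearMap.snd R S.Irr.carrier (ℕ →₀ S.Red.carrier))

/-- The small equivariant complex `Č = C ⊕ 𝖱[[x⁻¹,x]/𝖱[x]`, the tail modelled as `ℕ → 𝖱`
(the `m`-th coordinate is the coefficient of `x^{-m-1}`). -/
abbrev checkC (S : SCData R) : Type u := S.Irr.carrier × (ℕ → S.Red.carrier)

/-- The differential `𝔡̌(α, θxⁱ) = (dα, Σ_{j≤-1} δ₁v^{−j−1}(α)xʲ)`. -/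
noncomputable def checkD (S : SCData R) : checkC S →ₗ[R] checkC S :=
  LinearMap.prod (S.d ∘ₗ LinearMap.fst R S.Irr.carrier (ℕ → S.Red.carrier))
    (LinearMap.pi fun m : ℕ =>
      S.δ₁ ∘ₗ lpow S.v m ∘ₗ LinearMap.fst R S.Irr.carrier (ℕ → S.Red.carrier))

/-- The `x`-action on `Č`. -/
noncomputable def checkX (S : SCData R) : checkC S →ₗ[R] checkC S :=
  LinearMap.prod
    (S.v ∘ₗ LinearMap.fst R S.Irr.carrier (ℕ → S.Red.carrier) +
      S.δ₂ ∘ₗ LinearMap.proj 0 ∘ₗ LinearMap.snd R S.Irr.carrier (ℕ → S.Red.carrier))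
    (LinearMap.pi fun m : ℕ =>
      LinearMap.proj (m + 1) ∘ₗ LinearMap.snd R S.Irr.carrier (ℕ → S.Red.carrier))

/-- The module `𝖱[[x⁻¹,x]` of Laurent series with finitely many positive powers, modelled
as (polynomial part, tail): `(ℕ →₀ 𝖱) × (ℕ → 𝖱)`. -/
abbrev barC (S : SCData R) : Type u := (ℕ →₀ S.Red.carrier) × (ℕ → S.Red.carrier)

/-- Multiplication by `x` on `𝖱[[x⁻¹,x]`. -/
noncomputable def barX (S : SCData R) : barC S →ₗ[R] barC S :=
  LinearMap.prod
    (Finsupp.lsingle 0 ∘ₗ LinearMap.proj 0 ∘ₗ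
        LinearMap.snd R (ℕ →₀ S.Red.carrier) (ℕ → S.Red.carrier) +
      Finsupp.lmapDomain S.Red.carrier R (fun i => i + 1) ∘ₗ
        LinearMap.fst R (ℕ →₀ S.Red.carrier) (ℕ → S.Red.carrier))
    (LinearMap.pi fun m : ℕ =>
      LinearMap.proj (m + 1) ∘ₗ LinearMap.snd R (ℕ →₀ S.Red.carrier) (ℕ → S.Red.carrier))

/-- The chain map `𝔦 : Ĉ → 𝖱[[x⁻¹,x]`, `(α, θ) ↦ Σ_{i≤-1} δ₁v^{−i−1}(α)xⁱ + θ`. -/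
noncomputable def mapI (S : SCData R) : hatC S →ₗ[R] barC S :=
  LinearMap.prod (LinearMap.snd R S.Irr.carrier (ℕ →₀ S.Red.carrier))
    (LinearMap.pi fun m : ℕ =>
      S.δ₁ ∘ₗ lpow S.v m ∘ₗ LinearMap.fst R S.Irr.carrier (ℕ →₀ S.Red.carrier))

/-- The chain map `𝔧 : Č → Ĉ`, `(α, ·) ↦ (−α, 0)`. -/
noncomputable def mapJ (S : SCData R) : checkC S →ₗ[R] hatC S :=
  LinearMap.prod (-(LinearMap.fst R S.Irr.carrier (ℕ → S.Red.carrier))) 0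

/-- The chain map `𝔭 : 𝖱[[x⁻¹,x] → Č`, `Σθᵢxⁱ ↦ (Σ_{i≥0} vⁱδ₂θᵢ, Σ_{i≤-1} θᵢxⁱ)`. -/
noncomputable def mapP (S : SCData R) : barC S →ₗ[R] checkC S :=
  LinearMap.prod
    ((Finsupp.lsum ℕ fun i : ℕ => lpow S.v i ∘ₗ S.δ₂) ∘ₗ
      LinearMap.fst R (ℕ →₀ S.Red.carrier) (ℕ → S.Red.carrier))
    (LinearMap.snd R (ℕ →₀ S.Red.carrier) (ℕ → S.Red.carrier))

/-- The coefficient of `xᵉ`, as a linear map `𝖱[[x⁻¹,x] → 𝖱`. -/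
noncomputable def coeffLM (S : SCData R) (e : ℤ) : barC S →ₗ[R] S.Red.carrier :=
  if 0 ≤ e then
    Finsupp.lapply e.toNat ∘ₗ LinearMap.fst R (ℕ →₀ S.Red.carrier) (ℕ → S.Red.carrier)
  else
    LinearMap.proj (-e - 1).toNat ∘ₗ LinearMap.snd R (ℕ →₀ S.Red.carrier) (ℕ → S.Red.carrier)

/-- `𝔍(C~) ⊆ 𝖱[[x⁻¹,x]`, the image of `i⋆ : Ĥ → 𝖱[[x⁻¹,x]` (equal to `𝔦(ker 𝔡̂)`). -/
noncomputable def Jmod (S : SCData R) : Submodule R (barC S) :=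
  (LinearMap.ker (hatD S)).map (mapI S)

/-- `J_i(C~) = { a₀ ∈ 𝖱 | ∃ a₀x^{-i} + a₋₁x^{-i-1} + ⋯ ∈ 𝔍(C~) }`. -/
noncomputable def Jset (S : SCData R) (i : ℤ) : Submodule R S.Red.carrier :=
  ((Jmod S) ⊓ ⨅ (e : ℤ) (_ : -i < e), LinearMap.ker (coeffLM S e)).map (coeffLM S (-i))

/-- The function `d_{C~}(i) = rk_R J_i(C~)`. -/
noncomputable def dFun (S : SCData R) (i : ℤ) : ℕ := Module.finrank R ↥(Jset S i)

section SuspensionCoordinates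

variable {S T : SCData R}

theorem lpow_succ_apply {M : Type u} [AddCommGroup M] [Module R M] (f : M →ₗ[R] M) (i : ℕ)
    (x : M) : lpow f (i + 1) x = f (lpow f i x) := rfl

theorem lpow_apply_map {M : Type u} [AddCommGroup M] [Module R M] (f : M →ₗ[R] M) (i : ℕ)
    (x : M) : lpow f i (f x) = f (lpow f i x) := by
  induction i with
  | zero => rfl
  | succ i ih => rw [lpow_succ_apply, ih, lpow_succ_apply]

/-- The projection of the irreducible summand of `Σ^n C~` to that of `C~`. -/
def suspFst (T : SCData R) (n : ℕ) : (T.suspN n).Irr.carrier →ₗ[R] T.Irr.carrier :=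
  LinearMap.fst R T.Irr.carrier (Fin n → T.Red.carrier)

/-- The `m`-th reducible coordinate on the irreducible summand of `Σ^n C~`. -/
def suspCoord (T : SCData R) (n : ℕ) (m : Fin n) : (T.suspN n).Irr.carrier →ₗ[R] T.Red.carrier :=
  LinearMap.proj m ∘ₗ LinearMap.snd R T.Irr.carrier (Fin n → T.Red.carrier)

theorem suspN_ext {n : ℕ} {x y : (T.suspN n).Irr.carrier} (h₁ : suspFst T n x = suspFst T n y)
    (h₂ : ∀ m, suspCoord T n m x = suspCoord T n m y) : x = y :=
  Prod.ext h₁ (funext h₂)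

theorem suspFst_d (n : ℕ) (x : (T.suspN n).Irr.carrier) :
    suspFst T n ((T.suspN n).d x) = T.d (suspFst T n x) -
      ∑ m : Fin n, lpow T.v (m : ℕ) (T.δ₂ (suspCoord T n m x)) := by
  have h : suspFst T n ∘ₗ (T.suspN n).d = T.d ∘ₗ suspFst T n -
      ∑ m : Fin n, lpow T.v (m : ℕ) ∘ₗ T.δ₂ ∘ₗ suspCoord T n m := rfl
  simpa using LinearMap.congr_fun h x

theorem suspCoord_d (n : ℕ) (m : Fin n) (x : (T.suspN n).Irr.carrier) :
    suspCoord T n m ((T.suspN n).d x) = 0 := rfl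

theorem suspFst_v (n : ℕ) (x : (T.suspN n).Irr.carrier) :
    suspFst T n ((T.suspN n).v x) = T.v (suspFst T n x) := rfl

theorem suspCoord_v_zero (n : ℕ) (hn : 0 < n) (x : (T.suspN n).Irr.carrier) :
    suspCoord T n ⟨0, hn⟩ ((T.suspN n).v x) = T.δ₁ (suspFst T n x) := rfl

theorem suspCoord_v_succ (n m : ℕ) (hm : m + 1 < n) (x : (T.suspN n).Irr.carrier) :
    suspCoord T n ⟨m + 1, hm⟩ ((T.suspN n).v x) =
      suspCoord T n ⟨m, Nat.lt_of_succ_lt hm⟩ x := rfl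

theorem suspN_δ₁_apply (n : ℕ) (hn : 0 < n) (x : (T.suspN n).Irr.carrier) :
    (T.suspN n).δ₁ x = suspCoord T n ⟨n - 1, Nat.sub_lt hn Nat.one_pos⟩ x := by
  have h : (T.suspN n).δ₁ = suspCoord T n ⟨n - 1, Nat.sub_lt hn Nat.one_pos⟩ := dif_pos hn
  exact LinearMap.congr_fun h x

theorem suspCoord_δ₂ (n : ℕ) (m : Fin n) (θ : (T.suspN n).Red.carrier) :
    suspCoord T n m ((T.suspN n).δ₂ θ) = 0 := rfl

theorem suspFst_lpow_v (n l : ℕ) (x : (T.suspN n).Irr.carrier) :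
    suspFst T n (lpow (T.suspN n).v l x) = lpow T.v l (suspFst T n x) := by
  induction l with
  | zero => rfl
  | succ l ih => rw [lpow_succ_apply, suspFst_v, ih, lpow_succ_apply]

theorem suspCoord_lpow_v_add (n m l : ℕ) (h : m + l < n) (x : (T.suspN n).Irr.carrier) :
    suspCoord T n ⟨m + l, h⟩ (lpow (T.suspN n).v l x) = suspCoord T n ⟨m, by lia⟩ x := by
  induction l with
  | zero => rfl
  | succ l ih =>
    rw [lpow_succ_apply]
    exact (suspCoord_v_succ n (m + l) h _).trans (ih (by lia))

theorem suspCoord_lpow_v_of_lt (n m l : ℕ) (h : m < n) (x : (T.suspN n).Irr.carrier) :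
    suspCoord T n ⟨m, h⟩ (lpow (T.suspN n).v (m + 1 + l) x) =
      T.δ₁ (lpow T.v l (suspFst T n x)) := by
  induction m with
  | zero =>
    rw [show 0 + 1 + l = l + 1 by lia, lpow_succ_apply, suspCoord_v_zero, suspFst_lpow_v]
  | succ m ih =>
    rw [show m + 1 + 1 + l = m + 1 + l + 1 by lia, lpow_succ_apply, suspCoord_v_succ, ih]

/-- For `l < n`, the map `δ₁ v^l` on `Σ^n C~` reads off the coordinate `n - 1 - l`. -/
theorem suspN_δ₁_lpow_v_of_lt (n m l : ℕ) (h : m + l + 1 = n) (x : (T.suspN n).Irr.carrier) :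
    (T.suspN n).δ₁ (lpow (T.suspN n).v l x) = suspCoord T n ⟨m, by lia⟩ x := by
  subst h
  rw [suspN_δ₁_apply _ (by lia)]
  exact suspCoord_lpow_v_add _ m l _ x

/-- The map `δ₁ v^(n+l)` on `Σ^n C~` is `δ₁ v^l` on the `C~`-coordinate. -/
theorem suspN_δ₁_lpow_v_add (n l : ℕ) (hn : 0 < n) (x : (T.suspN n).Irr.carrier) :
    (T.suspN n).δ₁ (lpow (T.suspN n).v (n + l) x) = T.δ₁ (lpow T.v l (suspFst T n x)) := by
  obtain ⟨m, rfl⟩ : ∃ m, n = m + 1 := ⟨n - 1, by lia⟩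
  rw [suspN_δ₁_apply _ hn]
  exact suspCoord_lpow_v_of_lt _ m l _ x

variable (f : HMor S T) (n : ℕ)

theorem suspFst_heightNegToSusp_lam (x : S.Irr.carrier) :
    suspFst T n ((heightNegToSusp f n).lam x) = f.lam x := rfl

theorem suspCoord_heightNegToSusp_lam (m : Fin n) (x : S.Irr.carrier) :
    suspCoord T n m ((heightNegToSusp f n).lam x) =
      ∑ i ∈ Finset.Icc ((m : ℕ) + 1) n,
        f.tau (-(i : ℤ)) (S.δ₁ (lpow S.v (i - 1 - (m : ℕ)) x)) := by
  have h : suspCoord T n m ∘ₗ (heightNegToSusp f n).lam =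
      ∑ i ∈ Finset.Icc ((m : ℕ) + 1) n,
        f.tau (-(i : ℤ)) ∘ₗ S.δ₁ ∘ₗ lpow S.v (i - 1 - (m : ℕ)) := rfl
  simpa using LinearMap.congr_fun h x

theorem suspFst_heightNegToSusp_mu (x : S.Irr.carrier) :
    suspFst T n ((heightNegToSusp f n).mu x) = f.mu x := rfl

theorem suspCoord_heightNegToSusp_mu (m : Fin n) (x : S.Irr.carrier) :
    suspCoord T n m ((heightNegToSusp f n).mu x) = if (m : ℕ) = 0 then f.del1 x else 0 := by
  have h : suspCoord T n m ∘ₗ (heightNegToSusp f n).mu =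
      if (m : ℕ) = 0 then f.del1 else 0 := rfl
  have h' := LinearMap.congr_fun h x
  split_ifs at h' ⊢ <;> exact h'

theorem suspFst_heightNegToSusp_del2 (θ : S.Red.carrier) :
    suspFst T n ((heightNegToSusp f n).del2 θ) = f.del2 θ := rfl

theorem suspCoord_heightNegToSusp_del2 (m : Fin n) (θ : S.Red.carrier) :
    suspCoord T n m ((heightNegToSusp f n).del2 θ) = f.tau (-((m : ℕ) : ℤ)) θ := rfl

theorem heightNegToSusp_del1 : (heightNegToSusp f n).del1 = 0 := rfl

theorem suspFst_δ₂_heightNegToSusp_rho (θ : S.Red.carrier) :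
    suspFst T n ((T.suspN n).δ₂ ((heightNegToSusp f n).rho θ)) =
      lpow T.v n (T.δ₂ (f.tau (-(n : ℤ)) θ)) := rfl

end SuspensionCoordinates

section Vanishing

variable {S T : SCData R}

theorem SCData.RPerfect.δ₁_lpow_v_δ₂ (hS : S.RPerfect) (i : ℕ) (θ : S.Red.carrier) :
    S.δ₁ (lpow S.v i (S.δ₂ θ)) = 0 :=
  LinearMap.congr_fun (hS.2.2 i) θ

theorem SCData.RPerfect.δ₁_lpow_v_d (hS : S.RPerfect) (hR : S.Relations) (i : ℕ)
    (x : S.Irr.carrier) : S.δ₁ (lpow S.v i (S.d x)) = 0 := by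
  induction i generalizing x with
  | zero =>
    have h := LinearMap.congr_fun hR.2.1 x
    simpa [hS.2.1, lpow] using h
  | succ i ih =>
    have h := LinearMap.congr_fun hR.2.2.2.1 x
    simp only [LinearMap.sub_apply, LinearMap.comp_apply, LinearMap.zero_apply] at h
    have hv : S.v (S.d x) = S.d (S.v x) - S.δ₂ (S.δ₁ x) := by
      linear_combination (norm := abel) -h
    rw [lpow_succ_apply, ← lpow_apply_map, hv, map_sub, map_sub, ih, hS.δ₁_lpow_v_δ₂, sub_zero]

theorem finsum_eq_sum_range_of_forall_ge {M : Type*} [AddCommMonoid M] (g : ℕ → M) (n : ℕ)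
    (h : ∀ i, n ≤ i → g i = 0) : ∑ᶠ i, g i = ∑ i ∈ Finset.range n, g i := by
  refine finsum_eq_sum_of_support_subset _ fun i hi => ?_
  by_contra hin
  exact hi (h i (by simpa using hin))

/-- Composition of homogeneous maps. -/
theorem GradedMod.IsDeg.comp {M N P : GradedMod R} {a b : ℤ} {g : N.carrier →ₗ[R] P.carrier}
    {f : M.carrier →ₗ[R] N.carrier} (hg : N.IsDeg P b g) (hf : M.IsDeg N a f) :
    M.IsDeg P (a + b) (g ∘ₗ f) := by
  rintro i _ ⟨x, hx, rfl⟩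
  have h := hg (i + a) ⟨f x, hf i ⟨x, hx, rfl⟩, rfl⟩
  rwa [add_assoc] at h

theorem GradedMod.IsDeg.lpow {M : GradedMod R} {a : ℤ} {f : M.carrier →ₗ[R] M.carrier}
    (hf : M.IsDeg M a f) (i : ℕ) : M.IsDeg M (i * a) (lpow f i) := by
  induction i with
  | zero =>
    rintro j _ ⟨x, hx, rfl⟩
    simpa [_root_.lpow] using hx
  | succ i ih =>
    have h := hf.comp ih
    rwa [show (i : ℤ) * a + a = ((i + 1 : ℕ) : ℤ) * a by push_cast; ring] at h

theorem suspN_mem_grading {n : ℕ} {j : ℤ} {x : (T.suspN n).Irr.carrier}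
    (h₁ : suspFst T n x ∈ T.Irr.grading (j - 2 * (n : ℤ)))
    (h₂ : ∀ m : Fin n, suspCoord T n m x ∈
      T.Red.grading (j - 2 * (((n - 1 - (m : ℕ) : ℕ)) : ℤ) - 1)) :
    x ∈ (T.suspN n).Irr.grading j :=
  ⟨h₁, fun m _ => h₂ m⟩

end Vanishing

section HeightNegToSusp

variable {S T : SCData R} {n : ℕ} {k : ℤ} {f : HMor S T}

theorem heightNegToSusp_degreesAt (hS : S.Degrees)
    (hf : f.IsHeightMor (-(n : ℤ)) k) :
    (heightNegToSusp f n).DegreesAt (k + 2 * (n : ℤ)) := by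
  obtain ⟨-, hlam, hmu, hdel1, hdel2, htau, -⟩ := hf
  obtain ⟨-, hv, hδ₁, -⟩ := hS
  refine ⟨?_, ?_, ?_, ?_, ?_⟩
  · rintro i _ ⟨x, hx, rfl⟩
    refine suspN_mem_grading ?_ fun m => ?_
    · rw [suspFst_heightNegToSusp_lam]
      convert hlam i ⟨x, hx, rfl⟩ using 2
      ring
    · rw [suspCoord_heightNegToSusp_lam]
      refine Submodule.sum_mem _ fun l hl => ?_
      have hl := Finset.mem_Icc.1 hl
      convert ((htau (-(l : ℤ))).comp (hδ₁.comp (hv.lpow (l - 1 - m)))) i ⟨x, hx, rfl⟩ using 2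
      · lia
      · rfl
  · rintro i _ ⟨x, hx, rfl⟩
    refine suspN_mem_grading ?_ fun m => ?_
    · rw [suspFst_heightNegToSusp_mu]
      convert hmu i ⟨x, hx, rfl⟩ using 2
      ring
    · rw [suspCoord_heightNegToSusp_mu]
      split_ifs with hm
      · convert hdel1 i ⟨x, hx, rfl⟩ using 2
        lia
      · exact Submodule.zero_mem _
  · rintro i _ ⟨x, hx, rfl⟩
    exact Submodule.zero_mem _
  · rintro i _ ⟨x, hx, rfl⟩
    refine suspN_mem_grading ?_ fun m => ?_
    · rw [suspFst_heightNegToSusp_del2]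
      convert hdel2 i ⟨x, hx, rfl⟩ using 2
      ring
    · rw [suspCoord_heightNegToSusp_del2]
      convert htau (-((m : ℕ) : ℤ)) i ⟨x, hx, rfl⟩ using 2
      omega
  · have h := htau (-(n : ℤ))
    rwa [show k - 2 * -(n : ℤ) = k + 2 * n by ring] at h

/-- The first relation of a height `-n` morphism, with its double sum reindexed by the exponent
of `v'`. -/
theorem HMor.IsHeightMor.d_lam (hf : f.IsHeightMor (-(n : ℤ)) k) (x : S.Irr.carrier) :
    T.d (f.lam x) - f.lam (S.d x) = ∑ m : Fin n, lpow T.v (m : ℕ) (T.δ₂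
      (∑ i ∈ Finset.Icc ((m : ℕ) + 1) n,
        f.tau (-(i : ℤ)) (S.δ₁ (lpow S.v (i - 1 - (m : ℕ)) x)))) := by
  obtain ⟨-, -, -, -, -, -, hzero, -, h, -⟩ := hf
  rw [finsum_eq_sum_range_of_forall_ge _ n fun i hi => Finset.sum_eq_zero fun j _ => by
    rw [hzero _ (by lia)]; simp] at h
  have h := LinearMap.congr_fun h x
  simp only [LinearMap.sub_apply, LinearMap.comp_apply, LinearMap.zero_apply,
    LinearMap.sum_apply] at h
  rw [sub_eq_zero.1 h, Fin.sum_univ_eq_sum_range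
    (fun m => lpow T.v m (T.δ₂ (∑ i ∈ Finset.Icc (m + 1) n,
        f.tau (-(i : ℤ)) (S.δ₁ (lpow S.v (i - 1 - m) x))))) n]
  simp only [map_sum]
  rw [Finset.sum_sigma', Finset.sum_sigma']
  refine Finset.sum_bij' (fun p _ => ⟨p.2, p.1 + 1⟩) (fun p _ => ⟨p.2 - 1, p.1⟩) ?_ ?_ ?_ ?_ ?_
  · rintro ⟨i, j⟩ hp
    simp only [Finset.mem_sigma, Finset.mem_range, Finset.mem_Icc] at hp ⊢
    lia
  · rintro ⟨i, j⟩ hp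
    simp only [Finset.mem_sigma, Finset.mem_range, Finset.mem_Icc] at hp ⊢
    lia
  · rintro ⟨i, j⟩ hp
    simp
  · rintro ⟨i, j⟩ hp
    simp only [Finset.mem_sigma, Finset.mem_range, Finset.mem_Icc] at hp
    simp only [Sigma.mk.injEq, heq_eq_eq, true_and]
    lia
  · rintro ⟨i, j⟩ hp
    simp

theorem HMor.IsHeightMor.δ₁_lam (hf : f.IsHeightMor (-(n : ℤ)) k) (x : S.Irr.carrier) :
    f.del1 (S.d x) + ∑ i ∈ Finset.range (n + 1), f.tau (-(i : ℤ)) (S.δ₁ (lpow S.v i x)) =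
      T.δ₁ (f.lam x) := by
  obtain ⟨-, -, -, -, -, -, hzero, -, -, h, -⟩ := hf
  rw [finsum_eq_sum_range_of_forall_ge _ (n + 1) fun i hi => by
    rw [hzero _ (by lia)]; simp] at h
  have h := LinearMap.congr_fun h x
  simp only [LinearMap.add_apply, LinearMap.neg_apply, LinearMap.comp_apply,
    LinearMap.zero_apply, LinearMap.sum_apply] at h
  linear_combination (norm := abel) h

theorem HMor.IsHeightMor.lam_δ₂ (hf : f.IsHeightMor (-(n : ℤ)) k) (θ : S.Red.carrier) :
    f.lam (S.δ₂ θ) + T.d (f.del2 θ) =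
      ∑ i ∈ Finset.range (n + 1), lpow T.v i (T.δ₂ (f.tau (-(i : ℤ)) θ)) := by
  obtain ⟨-, -, -, -, -, -, hzero, -, -, -, h, -⟩ := hf
  rw [finsum_eq_sum_range_of_forall_ge _ (n + 1) fun i hi => by
    rw [hzero _ (by lia)]; simp] at h
  have h := LinearMap.congr_fun h θ
  simp only [LinearMap.add_apply, LinearMap.sub_apply, LinearMap.comp_apply,
    LinearMap.zero_apply, LinearMap.sum_apply] at h
  linear_combination (norm := abel) h

theorem heightNegToSusp_relations (hR : S.Relations) (hSr : S.RPerfect) (hn : 1 ≤ n)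
    (hf : f.IsHeightMor (-(n : ℤ)) k) : (heightNegToSusp f n).IsMor := by
  refine ⟨?_, ?_, ?_, ?_, ?_⟩
  · ext x
    simp only [LinearMap.sub_apply, LinearMap.comp_apply, LinearMap.zero_apply]
    refine suspN_ext ?_ fun m => ?_
    · rw [map_sub, suspFst_d, suspFst_heightNegToSusp_lam, suspFst_heightNegToSusp_lam, map_zero]
      simp only [suspCoord_heightNegToSusp_lam]
      rw [← hf.d_lam]
      abel
    · simp [suspCoord_d, suspCoord_heightNegToSusp_lam, hSr.δ₁_lpow_v_d hR]
  · ext x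
    simp only [heightNegToSusp_del1, LinearMap.sub_apply, LinearMap.add_apply,
      LinearMap.comp_apply, LinearMap.zero_apply, map_zero, zero_add, sub_zero]
    rw [sub_eq_zero, suspN_δ₁_apply n hn, suspCoord_heightNegToSusp_lam]
    simp only [Nat.sub_add_cancel hn, Finset.Icc_self, Finset.sum_singleton, Nat.sub_self]
    rfl
  · ext θ
    simp only [hSr.2.1, LinearMap.sub_apply, LinearMap.add_apply,
      LinearMap.comp_apply, LinearMap.zero_apply, LinearMap.comp_zero, add_zero]
    refine suspN_ext ?_ fun m => ?_
    · rw [map_add, map_sub, suspFst_d, suspFst_δ₂_heightNegToSusp_rho, suspFst_heightNegToSusp_lam,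
        suspFst_heightNegToSusp_del2, map_zero]
      simp only [suspCoord_heightNegToSusp_del2]
      have h := hf.lam_δ₂ θ
      rw [Finset.sum_range_succ] at h
      rw [Fin.sum_univ_eq_sum_range (fun m => lpow T.v m (T.δ₂ (f.tau (-(m : ℤ)) θ))) n]
      linear_combination (norm := abel) h
    · simp [suspCoord_d, suspCoord_δ₂, suspCoord_heightNegToSusp_lam, hSr.δ₁_lpow_v_δ₂]
  · ext x
    simp only [heightNegToSusp_del1, LinearMap.sub_apply, LinearMap.add_apply,
      LinearMap.comp_apply, LinearMap.zero_apply, LinearMap.comp_zero, sub_zero]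
    refine suspN_ext ?_ fun m => ?_
    · simp only [map_add, map_sub, map_zero, suspFst_d, suspFst_v, suspFst_heightNegToSusp_lam,
        suspFst_heightNegToSusp_mu, suspFst_heightNegToSusp_del2, suspCoord_heightNegToSusp_mu]
      have h := LinearMap.congr_fun hf.2.2.2.2.2.2.2.2.2.2.2 x
      simp only [LinearMap.sub_apply, LinearMap.add_apply, LinearMap.comp_apply,
        LinearMap.zero_apply] at h
      rw [Fin.sum_univ_eq_sum_range
        (fun m => lpow T.v m (T.δ₂ (if m = 0 then f.del1 x else 0))) n,
        Finset.sum_eq_single_of_mem 0 (Finset.mem_range.2 hn) fun m _ hm => by simp [hm],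
        if_pos rfl]
      change _ + (_ - T.δ₂ (f.del1 x)) + _ - _ + _ = 0
      linear_combination (norm := abel) h
    · obtain ⟨m, hm⟩ := m
      simp only [map_add, map_sub, map_zero, suspCoord_d, suspCoord_heightNegToSusp_lam,
        suspCoord_heightNegToSusp_mu, suspCoord_heightNegToSusp_del2, lpow_apply_map,
        ← lpow_succ_apply]
      rcases m with _ | m
      · rw [suspCoord_v_zero, suspFst_heightNegToSusp_lam, ← hf.δ₁_lam x,
          Finset.sum_range_succ', ← Finset.Ico_add_one_right_eq_Icc, Finset.sum_Ico_eq_sum_range]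
        simp [add_comm 1, lpow]
      · rw [suspCoord_v_succ, suspCoord_heightNegToSusp_lam,
          ← Finset.add_sum_Ioc_eq_sum_Icc (show m + 1 ≤ n by lia), ← Finset.Icc_add_one_left_eq_Ioc]
        have h : ∀ i ∈ Finset.Icc (m + 1 + 1) n,
            f.tau (-(i : ℤ)) (S.δ₁ (lpow S.v (i - 1 - (m + 1) + 1) x)) =
              f.tau (-(i : ℤ)) (S.δ₁ (lpow S.v (i - 1 - m) x)) := fun i hi => by
          have hi := Finset.mem_Icc.1 hi
          rw [show i - 1 - (m + 1) + 1 = i - 1 - m by lia]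
        rw [Finset.sum_congr rfl h]
        simp [lpow]
  · rw [hSr.2.1, LinearMap.comp_zero, zero_sub, neg_eq_zero]
    exact LinearMap.zero_comp _

theorem suspN_δ₁_lpow_v_heightNegToSusp_mu (f : HMor S T) {l : ℕ} (hl : l + 1 < n)
    (x : S.Irr.carrier) :
    (T.suspN n).δ₁ (lpow (T.suspN n).v l ((heightNegToSusp f n).mu x)) = 0 := by
  rw [suspN_δ₁_lpow_v_of_lt n (n - 1 - l) l (by lia), suspCoord_heightNegToSusp_mu,
    if_neg (by simp only; lia)]
  rfl

theorem suspN_δ₁_lpow_v_heightNegToSusp_mu_last (f : HMor S T) {l : ℕ} (hl : l + 1 = n)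
    (x : S.Irr.carrier) :
    (T.suspN n).δ₁ (lpow (T.suspN n).v l ((heightNegToSusp f n).mu x)) = f.del1 x := by
  rw [suspN_δ₁_lpow_v_of_lt n 0 l (by lia), suspCoord_heightNegToSusp_mu, if_pos rfl]

/-- The map `δ₁` of `Σ^n C~`, with values in the reducible summand of `C~`. -/
def suspDelta1 (T : SCData R) (n : ℕ) : (T.suspN n).Irr.carrier →ₗ[R] T.Red.carrier :=
  (T.suspN n).δ₁

/-- The `τ`-sequence of the associated map is that of `λ~` shifted by `n`. -/
theorem tauSMap_heightNegToSusp (hn : 1 ≤ n) (hf : f.IsHeightMor (-(n : ℤ)) k) (i : ℕ) :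
    tauSMap (heightNegToSusp f n) i = f.tau ((i : ℤ) - n) := by
  rcases i with _ | p
  · rw [Nat.cast_zero, zero_sub]
    rfl
  · have hsucc : tauSMap (heightNegToSusp f n) (p + 1) =
        suspDelta1 T n ∘ₗ lpow (T.suspN n).v p ∘ₗ (heightNegToSusp f n).del2 +
          (0 : S.Irr.carrier →ₗ[R] T.Red.carrier) ∘ₗ lpow S.v p ∘ₗ S.δ₂ +
          ∑ j ∈ Finset.range p, suspDelta1 T n ∘ₗ lpow (T.suspN n).v j ∘ₗ
            (heightNegToSusp f n).mu ∘ₗ lpow S.v (p - 1 - j) ∘ₗ S.δ₂ := rfl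
    have hmu : ∀ l x, l + 1 < n →
        suspDelta1 T n (lpow (T.suspN n).v l ((heightNegToSusp f n).mu x)) = 0 :=
      fun l x hl => suspN_δ₁_lpow_v_heightNegToSusp_mu f hl x
    refine hsucc.trans (LinearMap.ext fun θ => ?_)
    simp only [LinearMap.add_apply, LinearMap.comp_apply,
      LinearMap.sum_apply, LinearMap.zero_apply, add_zero]
    rcases lt_or_ge p n with hp | hp
    · have hdel2 : suspDelta1 T n (lpow (T.suspN n).v p ((heightNegToSusp f n).del2 θ)) =
          f.tau (-((n - 1 - p : ℕ) : ℤ)) θ :=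
        suspN_δ₁_lpow_v_of_lt n (n - 1 - p) p (by lia) _
      rw [hdel2, Finset.sum_eq_zero fun j hj => hmu j _ (by have := Finset.mem_range.1 hj; lia),
        add_zero]
      congr 2
      lia
    · obtain ⟨q, rfl⟩ := Nat.exists_eq_add_of_le hp
      obtain ⟨m, rfl⟩ : ∃ m, n = m + 1 := ⟨n - 1, by lia⟩
      have hlast : ∀ x, suspDelta1 T (m + 1)
          (lpow (T.suspN (m + 1)).v m ((heightNegToSusp f (m + 1)).mu x)) = f.del1 x :=
        suspN_δ₁_lpow_v_heightNegToSusp_mu_last f rfl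
      have hadd : ∀ l x, suspDelta1 T (m + 1) (lpow (T.suspN (m + 1)).v (m + 1 + l) x) =
          T.δ₁ (lpow T.v l (suspFst T (m + 1) x)) :=
        fun l x => suspN_δ₁_lpow_v_add (m + 1) l hn x
      rw [show ((m + 1 + q + 1 : ℕ) : ℤ) - (m + 1 : ℕ) = (q : ℤ) + 1 by push_cast; ring,
        hf.2.2.2.2.2.2.2.1 q, Finset.sum_range_add, Finset.sum_range_succ,
        Finset.sum_eq_zero fun j hj => hmu j _ (by have := Finset.mem_range.1 hj; lia)]
      simp only [hadd, hlast, suspFst_heightNegToSusp_del2, suspFst_heightNegToSusp_mu,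
        LinearMap.add_apply, LinearMap.comp_apply, LinearMap.sum_apply, zero_add, ← add_assoc]
      rw [show m + 1 + q - 1 - m = q by lia]
      refine congrArg _ (Finset.sum_congr rfl fun j _ => ?_)
      rw [show m + 1 + q - 1 - (m + 1 + j) = q - 1 - j by lia]

theorem kappaN_tau_of_ne (T : SCData R) {i : ℤ} (hi : i ≠ -(n : ℤ)) : (kappaN T n).tau i = 0 :=
  if_neg hi

theorem kappaN_tau_neg (T : SCData R) (n : ℕ) : (kappaN T n).tau (-(n : ℤ)) = LinearMap.id :=
  if_pos rfl

theorem HMor.ext_components {f g : HMor S T} (h₁ : f.lam = g.lam) (h₂ : f.mu = g.mu)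
    (h₃ : f.del1 = g.del1) (h₄ : f.del2 = g.del2) (h₅ : f.tau = g.tau) : f = g := by
  cases f
  cases g
  simp_all

theorem kappaN_compH_heightNegToSusp (hn : 1 ≤ n) (hf : f.IsHeightMor (-(n : ℤ)) k) :
    (kappaN T n).compH (heightNegToSusp f n).toHMor = f := by
  have hlam : (kappaN T n).lam = suspFst T n := rfl
  have hmu : (kappaN T n).mu = 0 := rfl
  have hdel1 : (kappaN T n).del1 = 0 := rfl
  have hdel2 : (kappaN T n).del2 = 0 := rfl
  refine HMor.ext_components ?_ ?_ ?_ ?_ ?_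
  · simp only [HMor.compH, SMap.toHMor, hlam, hmu, hdel2, heightNegToSusp_del1,
      LinearMap.zero_comp, LinearMap.comp_zero, Finset.sum_const_zero, finsum_zero, add_zero]
    have h : ∀ i : ℕ, (∑ j ∈ Finset.range (i + 1), ∑ l ∈ Finset.range (i - j + 1),
        lpow T.v j ∘ₗ T.δ₂ ∘ₗ (kappaN T n).tau (-((i : ℤ) + 2)) ∘ₗ (T.suspN n).δ₁ ∘ₗ
          lpow (T.suspN n).v l ∘ₗ (heightNegToSusp f n).mu ∘ₗ lpow S.v (i - j - l)) = 0 := by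
      refine fun i => Finset.sum_eq_zero fun j _ => Finset.sum_eq_zero fun l hl => ?_
      have hl := Finset.mem_range.1 hl
      by_cases hi : i + 2 = n
      · ext x
        simp only [LinearMap.comp_apply]
        rw [suspN_δ₁_lpow_v_heightNegToSusp_mu f (by lia)]
        simp
      · rw [kappaN_tau_of_ne T (by lia)]
        simp
    simp only [h, finsum_zero, add_zero]
    rfl
  · simp only [HMor.compH, SMap.toHMor, hlam, hmu, hdel2, LinearMap.zero_comp, add_zero]
    rfl
  · simp only [HMor.compH, SMap.toHMor, hdel1, heightNegToSusp_del1,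
      LinearMap.zero_comp, LinearMap.comp_zero, finsum_zero, zero_add]
    obtain ⟨m, rfl⟩ : ∃ m, n = m + 1 := ⟨n - 1, by lia⟩
    rw [finsum_eq_single _ m fun i hi => Finset.sum_eq_zero fun j _ => by
      rw [kappaN_tau_of_ne T (by lia), LinearMap.zero_comp]]
    ext x
    simp only [LinearMap.sum_apply, LinearMap.comp_apply]
    rw [Finset.sum_range_succ, Finset.sum_eq_zero fun j hj => by
      rw [suspN_δ₁_lpow_v_heightNegToSusp_mu f (by have := Finset.mem_range.1 hj; lia), map_zero],
      suspN_δ₁_lpow_v_heightNegToSusp_mu_last f rfl,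
      show -((m : ℤ) + 1) = -((m + 1 : ℕ) : ℤ) by push_cast; ring, kappaN_tau_neg]
    simp only [Nat.sub_self, zero_add]
    rfl
  · simp only [HMor.compH, SMap.toHMor, hlam, hmu, hdel2, LinearMap.zero_comp,
      LinearMap.comp_zero, Finset.sum_const_zero, finsum_zero, add_zero]
    rfl
  · funext i
    simp only [HMor.compH, SMap.toHMor]
    rw [finsum_eq_single _ (i + n) fun l hl => by
      rw [kappaN_tau_of_ne T (by lia), LinearMap.zero_comp],
      show i - (i + n) = -(n : ℤ) by ring, kappaN_tau_neg]
    refine (LinearMap.id_comp _).trans ?_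
    split_ifs with hi
    · rw [tauSMap_heightNegToSusp hn hf]
      congr 1
      lia
    · exact (hf.2.2.2.2.2.2.1 i (by lia)).symm

end HeightNegToSusp

/-- A height `−n` morphism `λ~ : C~ → C~'` (`n ≥ 1`) between `r`-perfect
`S`-complexes determines, by the explicit formulas, a height `0` morphism
`λ~' : C~ → Σ^n C~'` (strong height `0` if `λ~` is strong height `−n`) whose composition
with `κ~_n` (in the sense of the composition formulas for height morphisms) equals `λ~`. -/
theorem heightNegToSusp_isMor {R : Type u} [CommRing R] {S T : SCData R}
    (hS : S.IsSComplex) (hSr : S.RPerfect) (hT : T.IsSComplex) (hTr : T.RPerfect)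
    (n : ℕ) (hn : 1 ≤ n) (k : ℤ) (f : HMor S T) (hf : f.IsHeightMor (-(n : ℤ)) k) :
    (heightNegToSusp f n).IsMor ∧ (heightNegToSusp f n).DegreesAt (k + 2 * (n : ℤ)) ∧
    (heightNegToSusp f n).HasHeight 0 ∧
    (Function.Bijective ⇑(f.tau (-(n : ℤ))) →
      Function.Bijective ⇑((heightNegToSusp f n).rho)) ∧
    (kappaN T n).compH (heightNegToSusp f n).toHMor = f := by
  exact ⟨heightNegToSusp_relations hS.2.2.2 hSr hn hf, heightNegToSusp_degreesAt hS.2.2.1 hf,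
    fun j hj => absurd hj (Nat.not_lt_zero j), id, kappaN_compH_heightNegToSusp hn hf⟩
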